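/- arXiv:2103.10724 — 4 statements merged into one kernel-verified Lean document; each statement's English description precedes it below -/
import Mathlib

section
/- Let d ≥ 4 and let X:[0,T]×Ω→ℝ^d be a jointly measurable process such that there exists a constant c>0 with the following property: for all 0≤r<s≤T the law of X_s−X_r is absolutely continuous with respect to Lebesgue measure λ_d with a density p_{r,s} satisfying p_{r,s}(y) ≥ c·(s−r)^{−d/4}·exp(−‖y‖²/(c·(s−r)^{1/2})) for λ_d-almost every y∈ℝ^d. Then for every t∈(0,T], liminf_{ε→0⁺} ε^{−d} ∫_0^t ∫_0^t P(‖X_s−X_r‖ ≤ ε) dr ds = ∞. -/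
open MeasureTheory Filter Set
open scoped ENNReal NNReal

noncomputable section

/-- A Gaussian-type lower bound on the density of a measure gives a lower bound on the mass
of a centred ball, when the time parameter `u` lies between `ε ^ 4` and `1`. -/
theorem le_measure_closedBall_of_gaussian_lower_bound {d : ℕ} (hd : 4 ≤ d)
    {μ : Measure (EuclideanSpace ℝ (Fin d))} {c u ε : ℝ} (hc : 0 < c) (hε : 0 < ε)
    (hεu : ε ^ 4 ≤ u) (hu : u ≤ 1)
    (h : ∀ᵐ y ∂(volume : Measure (EuclideanSpace ℝ (Fin d))),
      c * u ^ (-(d : ℝ) / 4) * Real.exp (-‖y‖ ^ 2 / (c * u ^ ((1 : ℝ) / 2))) ≤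
        (μ.rnDeriv volume y).toReal) :
    ENNReal.ofReal (c * Real.exp (-1 / c) * u⁻¹) *
        (volume : Measure (EuclideanSpace ℝ (Fin d))) (Metric.closedBall 0 ε) ≤
      μ (Metric.closedBall 0 ε) := by
  have hu0 : 0 < u := (by positivity : 0 < ε ^ 4).trans_le hεu
  have hpow : u⁻¹ ≤ u ^ (-(d : ℝ) / 4) := by
    rw [← Real.rpow_neg_one]
    refine Real.rpow_le_rpow_of_exponent_ge hu0 hu ?_
    have : (4 : ℝ) ≤ d := by exact_mod_cast hd
    linarith
  have hsqrt : ε ^ 2 ≤ u ^ ((1 : ℝ) / 2) := by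
    rw [← Real.sqrt_eq_rpow]
    exact Real.le_sqrt_of_sq_le (by rw [← pow_mul]; exact hεu)
  refine le_trans ?_ (Measure.setLIntegral_rnDeriv_le (ν := volume) _)
  rw [← setLIntegral_const]
  refine lintegral_mono_ae ?_
  filter_upwards [ae_restrict_of_ae h, ae_restrict_mem Metric.isClosed_closedBall.measurableSet]
    with y hy hyε
  refine ENNReal.ofReal_le_of_le_toReal (le_trans ?_ hy)
  rw [mem_closedBall_zero_iff] at hyε
  have hexp : -1 / c ≤ -‖y‖ ^ 2 / (c * u ^ ((1 : ℝ) / 2)) := by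
    rw [div_le_div_iff₀ hc (by positivity)]
    have : ‖y‖ ^ 2 ≤ u ^ ((1 : ℝ) / 2) := (by gcongr : ‖y‖ ^ 2 ≤ ε ^ 2).trans hsqrt
    nlinarith
  calc c * Real.exp (-1 / c) * u⁻¹ = c * u⁻¹ * Real.exp (-1 / c) := by ring
    _ ≤ _ := by gcongr

theorem lintegral_Icc_const_mul_inv_sub {a δ m s : ℝ} (ha : 0 ≤ a) (hδ : 0 < δ) (hδm : δ ≤ m) :
    ∫⁻ r in Icc (s - m) (s - δ), ENNReal.ofReal (a * (s - r)⁻¹) =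
      ENNReal.ofReal (a * (Real.log m - Real.log δ)) := by
  have hcont : ContinuousOn (fun r => a * (s - r)⁻¹) (Icc (s - m) (s - δ)) := by
    refine continuousOn_const.mul (ContinuousOn.inv₀ (by fun_prop) fun r hr => ?_)
    have := hr.2
    linarith
  rw [← ofReal_integral_eq_lintegral_ofReal (hcont.integrableOn_Icc), integral_Icc_eq_integral_Ioc,
    ← intervalIntegral.integral_of_le (by linarith), intervalIntegral.integral_const_mul,
    intervalIntegral.integral_comp_sub_left (fun x => x⁻¹) s, sub_sub_cancel, sub_sub_cancel,
    integral_inv_of_pos hδ (hδ.trans_le hδm), Real.log_div (hδ.trans_le hδm).ne' hδ.ne']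
  filter_upwards [ae_restrict_mem measurableSet_Icc] with r hr
  have := hr.2
  exact mul_nonneg ha (inv_nonneg.2 (by linarith))

/-- Let `d ≥ 4` and `X` be a jointly measurable process whose increments `X_s − X_r`
(for `0 ≤ r < s ≤ T`) have laws absolutely continuous w.r.t. Lebesgue measure with
densities bounded below by `c (s−r)^{−d/4} exp(−‖y‖²/(c (s−r)^{1/2}))`. Then for every
`t ∈ (0,T]`,
`liminf_{ε→0⁺} ε^{−d} ∫_0^t ∫_0^t P(‖X_s−X_r‖ ≤ ε) dr ds = ∞`. -/
theorem liminf_small_ball_integral_eq_top_of_gaussian_lower_bound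
    {Ω : Type*} [MeasurableSpace Ω] (P : Measure Ω) [IsProbabilityMeasure P]
    (d : ℕ) (hd : 4 ≤ d) (T : ℝ) (hT : 0 < T)
    (X : ℝ → Ω → EuclideanSpace ℝ (Fin d))
    (hmeas : Measurable (Function.uncurry X))
    (hdens : ∃ c : ℝ, 0 < c ∧ ∀ r s : ℝ, 0 ≤ r → r < s → s ≤ T →
      (Measure.map (fun ω => X s ω - X r ω) P ≪
        (volume : Measure (EuclideanSpace ℝ (Fin d)))) ∧
      ∀ᵐ y ∂(volume : Measure (EuclideanSpace ℝ (Fin d))),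
        c * (s - r) ^ (-(d : ℝ) / 4) *
            Real.exp (-‖y‖ ^ 2 / (c * (s - r) ^ ((1 : ℝ) / 2))) ≤
          ((Measure.map (fun ω => X s ω - X r ω) P).rnDeriv volume y).toReal) :
    ∀ t : ℝ, 0 < t → t ≤ T →
      Filter.liminf (fun ε : ℝ =>
        ENNReal.ofReal (ε ^ (-(d : ℝ))) *
          ∫⁻ s in Set.Icc (0 : ℝ) t, ∫⁻ r in Set.Icc (0 : ℝ) t,
            P {ω | ‖X s ω - X r ω‖ ≤ ε} ∂volume ∂volume)
        (nhdsWithin 0 (Set.Ioi 0)) = ⊤ := by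
  intro t ht htT
  obtain ⟨c, hc, hX⟩ := hdens
  set V := (volume : Measure (EuclideanSpace ℝ (Fin d))) (Metric.ball 0 1) with hV
  have hVtop : V ≠ ⊤ := measure_ball_lt_top.ne
  have hV0 : 0 < V.toReal := ENNReal.toReal_pos (Metric.measure_ball_pos _ _ one_pos).ne' hVtop
  set m := min (t / 2) 1 with hm
  have hm0 : 0 < m := lt_min (by linarith) one_pos
  have hm1 : m ≤ 1 := min_le_right _ _
  have hmt : m ≤ t / 2 := min_le_left _ _
  set A := c * Real.exp (-1 / c) * V.toReal with hA
  have hA0 : 0 < A := by positivity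
  have hXm (s : ℝ) : Measurable (X s) := hmeas.comp measurable_prodMk_left
  have hball {ε r s : ℝ} (hε : 0 < ε) (hr : 0 ≤ r) (hs : s ≤ T) (hεrs : ε ^ 4 ≤ s - r)
      (hrs : s - r ≤ 1) :
      ENNReal.ofReal (A * ε ^ d * (s - r)⁻¹) ≤ P {ω | ‖X s ω - X r ω‖ ≤ ε} := by
    have hrs0 : 0 < s - r := (by positivity : 0 < ε ^ 4).trans_le hεrs
    have key := le_measure_closedBall_of_gaussian_lower_bound hd hc hε hεrs hrs
      (hX r s hr (by linarith) hs).2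
    have hXrs : Measurable fun ω => X s ω - X r ω := (hXm s).sub (hXm r)
    rw [Measure.map_apply hXrs Metric.isClosed_closedBall.measurableSet,
      Measure.addHaar_closedBall _ _ hε.le, finrank_euclideanSpace_fin, ← hV,
      ← ENNReal.ofReal_toReal hVtop, ← ENNReal.ofReal_mul (by positivity),
      ← ENNReal.ofReal_mul (by positivity)] at key
    convert key using 2
    · rw [hA]; ring
    · ext ω; simp
  have hlim : Tendsto (fun ε : ℝ => ENNReal.ofReal (t / 2 * A * (Real.log m - 4 * Real.log ε)))
      (nhdsWithin 0 (Ioi 0)) (nhds ⊤) := by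
    refine ENNReal.tendsto_ofReal_atTop.comp (Tendsto.const_mul_atTop (by positivity) ?_)
    simp only [sub_eq_add_neg, ← mul_neg]
    exact tendsto_atTop_add_const_left _ _ (Tendsto.const_mul_atTop (by norm_num)
      (tendsto_neg_atBot_atTop.comp Real.tendsto_log_nhdsGT_zero))
  refine (tendsto_nhds_top_mono hlim ?_).liminf_eq
  have hsmall : ∀ᶠ ε : ℝ in nhdsWithin 0 (Ioi 0), ε ^ 4 < m :=
    nhdsWithin_le_nhds (((continuous_pow 4).tendsto' (0 : ℝ) 0 (by simp)).eventually_lt_const hm0)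
  filter_upwards [hsmall, self_mem_nhdsWithin] with ε hεm hε
  rw [mem_Ioi] at hε
  have hlog : Real.log (ε ^ 4) = 4 * Real.log ε := by rw [Real.log_pow]; norm_num
  have hinner {s : ℝ} (hs : s ∈ Icc (t / 2) t) :
      ENNReal.ofReal (A * ε ^ d * (Real.log m - 4 * Real.log ε)) ≤
        ∫⁻ r in Icc (0 : ℝ) t, P {ω | ‖X s ω - X r ω‖ ≤ ε} := by
    have hε4 : 0 < ε ^ 4 := by positivity
    rw [← hlog, ← lintegral_Icc_const_mul_inv_sub (s := s) (by positivity) hε4 hεm.le]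
    calc _ ≤ ∫⁻ r in Icc (s - m) (s - ε ^ 4), P {ω | ‖X s ω - X r ω‖ ≤ ε} :=
          setLIntegral_mono' measurableSet_Icc fun r hr =>
            hball hε (by linarith [hr.1, hs.1]) (hs.2.trans htT) (by linarith [hr.2])
              (by linarith [hr.1])
      _ ≤ _ := lintegral_mono_set
          (Icc_subset_Icc (by linarith [hs.1]) (by linarith [hs.2]))
  calc ENNReal.ofReal (t / 2 * A * (Real.log m - 4 * Real.log ε))
      = ENNReal.ofReal (ε ^ (-(d : ℝ))) * ∫⁻ _ in Icc (t / 2) t,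
          ENNReal.ofReal (A * ε ^ d * (Real.log m - 4 * Real.log ε)) := by
        rw [setLIntegral_const, Real.volume_Icc, mul_comm (ENNReal.ofReal (A * _ * _)),
          ← ENNReal.ofReal_mul (by linarith), ← ENNReal.ofReal_mul (by positivity),
          Real.rpow_neg hε.le, Real.rpow_natCast]
        congr 1
        field_simp
        ring
    _ ≤ _ := mul_le_mul' le_rfl <|
        (setLIntegral_mono' measurableSet_Icc fun s hs => hinner hs).trans
          (lintegral_mono_set (Icc_subset_Icc_left (by linarith)))
end
end

section
/- Let d ≤ 3, suppose that Y is (1/4)-LND on [0,T] and that Y_0=0 almost surely. Then for every even integer m≥2 there exists a constant C_m>0 such that for all t,h with 0 ≤ t < t+h ≤ T, ∫_{[t,t+h]^m} ∫_{(ℝ^d)^m} | E[ exp( i ∑_{j=1}^m ⟨u_j, Y_{s_j}⟩ ) ] | du_1⋯du_m ds_1⋯ds_m ≤ C_m · h^{m(1−d/4)}. -/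
open MeasureTheory Filter Set
open scoped ENNReal NNReal RealInnerProductSpace

noncomputable section

/-- `Y` is `α`-LND on `[0,T]`. -/
def IsLND {Ω : Type*} [MeasurableSpace Ω] (P : Measure Ω) (d : ℕ)
    (Y : ℝ → Ω → EuclideanSpace ℝ (Fin d)) (T α : ℝ) : Prop :=
  ∀ m : ℕ, 2 ≤ m → ∀ k : Fin m → Fin d → ℕ, ∃ c : ℝ, 0 < c ∧
    ∀ v : Fin m → EuclideanSpace ℝ (Fin d), (∀ j l, v j l ≠ 0) →
      ∀ t : Fin (m + 1) → ℝ, t 0 = 0 → StrictMono t → t (Fin.last m) ≤ T →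
        ‖∫ ω, Complex.exp (Complex.I *
            ((∑ j : Fin m, (⟪v j, Y (t j.succ) ω - Y (t j.castSucc) ω⟫ : ℝ)) : ℂ)) ∂P‖ ≤
          c * ∏ j : Fin m, ∏ l : Fin d,
            (|v j l| ^ k j l)⁻¹ * ((t j.succ - t j.castSucc) ^ (α * (k j l : ℝ)))⁻¹

/-- Tonelli for a product of functions of the separate coordinates. -/
lemma lintegral_fin_prod {E : Type*} [MeasureSpace E] [SigmaFinite (volume : Measure E)] {n : ℕ}
    (f : Fin n → E → ℝ≥0∞) (hf : ∀ i, Measurable (f i)) :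
    ∫⁻ x : Fin n → E, ∏ i, f i (x i) = ∏ i, ∫⁻ x, f i x := by
  induction n with
  | zero => simp [volume_pi]
  | succ n ih =>
    rw [← ((volume_preserving_piFinSuccAbove (fun _ : Fin (n + 1) => E) 0).symm).lintegral_comp_emb
      (MeasurableEquiv.measurableEmbedding _)]
    simp_rw [MeasurableEquiv.piFinSuccAbove_symm_apply, Fin.insertNthEquiv,
      Fin.prod_univ_succ, Fin.insertNth_zero]
    simp only [Equiv.coe_fn_mk, Fin.cons_succ, Fin.cons_zero]
    rw [← ih _ fun i => hf (Fin.succ i), Measure.volume_eq_prod]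
    exact lintegral_prod_mul (hf 0).aemeasurable
      (Finset.measurable_prod _ fun i _ => (hf (Fin.succ i)).comp (measurable_pi_apply i)).aemeasurable

/-- An injective linear endomorphism multiplies Lebesgue integrals by a finite constant. -/
lemma exists_lintegral_comp_linearMap {V : Type*} [NormedAddCommGroup V] [NormedSpace ℝ V]
    [FiniteDimensional ℝ V] [MeasurableSpace V] [BorelSpace V] (μ : Measure V)
    [μ.IsAddHaarMeasure] (L : V →ₗ[ℝ] V) (hL : Function.Injective L) :
    ∃ c : ℝ, 0 ≤ c ∧ ∀ f : V → ℝ≥0∞, Measurable f →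
      ∫⁻ x, f (L x) ∂μ = ENNReal.ofReal c * ∫⁻ x, f x ∂μ := by
  have hdet : LinearMap.det L ≠ 0 := by
    have := (LinearEquiv.ofInjectiveEndo L hL).isUnit_det'
    exact this.ne_zero
  refine ⟨|(LinearMap.det L)⁻¹|, abs_nonneg _, fun f hf => ?_⟩
  rw [← lintegral_map hf L.continuous_of_finiteDimensional.measurable,
    Measure.map_linearMap_addHaar_eq_smul_addHaar μ hdet, lintegral_smul_measure, smul_eq_mul]

/-- A nonzero linear functional vanishes almost nowhere. -/
lemma ae_linearMap_ne_zero {V : Type*} [NormedAddCommGroup V] [NormedSpace ℝ V]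
    [FiniteDimensional ℝ V] [MeasurableSpace V] [BorelSpace V] (μ : Measure V)
    [μ.IsAddHaarMeasure] (f : V →ₗ[ℝ] ℝ) {x : V} (hx : f x ≠ 0) : ∀ᵐ y ∂μ, f y ≠ 0 := by
  have h := Measure.addHaar_submodule μ (LinearMap.ker f) fun h => hx <| by
    have : x ∈ LinearMap.ker f := h ▸ Submodule.mem_top
    simpa using this
  rw [ae_iff]
  convert h using 2
  ext y
  simp

lemma lintegral_two_div_one_add_mul_sq {a : ℝ} (ha : 0 < a) :
    ∫⁻ x : ℝ, ENNReal.ofReal (2 * (1 + (a * x) ^ 2)⁻¹) = ENNReal.ofReal (2 * Real.pi * a⁻¹) := by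
  rw [← ofReal_integral_eq_lintegral_ofReal]
  · rw [integral_const_mul, Measure.integral_comp_mul_left (fun x : ℝ => (1 + x ^ 2)⁻¹) a,
      integral_univ_inv_one_add_sq, abs_of_pos (inv_pos.2 ha), smul_eq_mul]
    ring_nf
  · exact (integrable_inv_one_add_sq.comp_mul_left' ha.ne').const_mul 2
  · exact Filter.Eventually.of_forall fun x => by positivity

lemma lintegral_Ioc_rpow {r h : ℝ} (hr : -1 < r) (hh : 0 < h) :
    ∫⁻ x : ℝ, (Ioc 0 h).indicator (fun x => ENNReal.ofReal (x ^ r)) x =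
      ENNReal.ofReal (h ^ (r + 1) / (r + 1)) := by
  rw [lintegral_indicator measurableSet_Ioc, ← ofReal_integral_eq_lintegral_ofReal]
  · rw [← intervalIntegral.integral_of_le hh.le, integral_rpow (Or.inl hr),
      Real.zero_rpow (by linarith), sub_zero]
  · exact (intervalIntegral.intervalIntegrable_rpow' hr).1
  · filter_upwards [ae_restrict_mem measurableSet_Ioc] with x hx
    exact Real.rpow_nonneg hx.1.le _

/-- The tail sums of a finite sequence, as a linear map. -/
def tailSum (E : Type*) [AddCommGroup E] [Module ℝ E] (m : ℕ) : (Fin m → E) →ₗ[ℝ] (Fin m → E) :=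
  LinearMap.pi fun j => ∑ i ∈ Finset.Ici j, LinearMap.proj i

lemma tailSum_apply {E : Type*} [AddCommGroup E] [Module ℝ E] {m : ℕ} (u : Fin m → E)
    (j : Fin m) : tailSum E m u j = ∑ i ∈ Finset.Ici j, u i := by
  simp [tailSum]

/-- Summation by parts. -/
lemma sum_inner_tailSum {E : Type*} [NormedAddCommGroup E] [InnerProductSpace ℝ E] {m : ℕ}
    (u : Fin m → E) (y : Fin (m + 1) → E) (hy : y 0 = 0) :
    ∑ j, ⟪tailSum E m u j, y j.succ - y j.castSucc⟫ = ∑ j, ⟪u j, y j.succ⟫ := by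
  simp_rw [tailSum_apply, sum_inner]
  rw [Finset.sum_comm' (t' := Finset.univ) (s' := fun i => Finset.Iic i) (by simp)]
  refine Finset.sum_congr rfl fun i _ => ?_
  rw [← inner_sum, Fin.sum_Iic_sub i y, hy, sub_zero]

lemma tailSum_injective (E : Type*) [NormedAddCommGroup E] [InnerProductSpace ℝ E] (m : ℕ) :
    Function.Injective (tailSum E m) := by
  rw [injective_iff_map_eq_zero]
  intro u hu
  have h := sum_inner_tailSum u (Fin.cons 0 u) rfl
  simp only [hu, Pi.zero_apply, inner_zero_left, Finset.sum_const_zero, Fin.cons_succ] at h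
  have := (Finset.sum_eq_zero_iff_of_nonneg fun i _ => real_inner_self_nonneg).1 h.symm
  ext1 i
  simpa using this i (Finset.mem_univ i)

/-- The increments of the sequence `s ∘ σ`, starting from `0`. -/
def permIncr {m : ℕ} (σ : Equiv.Perm (Fin m)) : (Fin m → ℝ) →ₗ[ℝ] (Fin m → ℝ) where
  toFun s j := (Fin.cons 0 (s ∘ σ) : Fin (m + 1) → ℝ) j.succ -
    (Fin.cons 0 (s ∘ σ) : Fin (m + 1) → ℝ) j.castSucc
  map_add' s s' := by
    ext j
    rcases Fin.eq_zero_or_eq_succ j.castSucc with h | ⟨i, h⟩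
    · simp [h]
    · simp [h]; ring
  map_smul' c s := by
    ext j
    rcases Fin.eq_zero_or_eq_succ j.castSucc with h | ⟨i, h⟩
    · simp [h]
    · simp [h]; ring

lemma permIncr_apply {m : ℕ} (σ : Equiv.Perm (Fin m)) (s : Fin m → ℝ) (j : Fin m) :
    permIncr σ s j = (Fin.cons 0 (s ∘ σ) : Fin (m + 1) → ℝ) j.succ -
      (Fin.cons 0 (s ∘ σ) : Fin (m + 1) → ℝ) j.castSucc := rfl

lemma permIncr_injective {m : ℕ} (σ : Equiv.Perm (Fin m)) :
    Function.Injective (permIncr σ) := by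
  rw [injective_iff_map_eq_zero]
  intro s hs
  have h : ∀ i, s (σ i) = 0 := fun i => by
    have h := Fin.sum_Iic_sub i (Fin.cons 0 (s ∘ σ) : Fin (m + 1) → ℝ)
    simp_rw [← permIncr_apply, hs] at h
    simpa using h.symm
  ext i
  simpa using h (σ.symm i)

/-- Interpolation of the LND bounds with exponents `0` and `2`. -/
lemma IsLND.exists_bound {Ω : Type*} [MeasurableSpace Ω] {P : Measure Ω} {d : ℕ}
    {Y : ℝ → Ω → EuclideanSpace ℝ (Fin d)} {T α : ℝ} (hLND : IsLND P d Y T α) {m : ℕ}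
    (hm : 2 ≤ m) :
    ∃ c : ℝ, 0 < c ∧ ∀ v : Fin m → EuclideanSpace ℝ (Fin d), (∀ j l, v j l ≠ 0) →
      ∀ t : Fin (m + 1) → ℝ, t 0 = 0 → StrictMono t → t (Fin.last m) ≤ T →
        ‖∫ ω, Complex.exp (Complex.I *
            ((∑ j : Fin m, (⟪v j, Y (t j.succ) ω - Y (t j.castSucc) ω⟫ : ℝ)) : ℂ)) ∂P‖ ≤
          c * ∏ j : Fin m, ∏ l : Fin d,
            (2 * (1 + ((t j.succ - t j.castSucc) ^ α * v j l) ^ 2)⁻¹) := by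
  choose c hc0 hc using fun k : Fin m → Fin d → Bool =>
    hLND m hm fun j l => if k j l then 2 else 0
  refine ⟨∑ k, c k, Finset.sum_pos (fun k _ => hc0 k) ⟨fun _ _ => false, Finset.mem_univ _⟩,
    fun v hv t ht0 ht htT => ?_⟩
  let k : Fin m → Fin d → Bool :=
    fun j l => decide (1 ≤ ((t j.succ - t j.castSucc) ^ α * v j l) ^ 2)
  refine (hc k v hv t ht0 ht htT).trans ?_
  have hΔ : ∀ j : Fin m, 0 < t j.succ - t j.castSucc :=
    fun j => sub_pos.2 (ht (Fin.castSucc_lt_succ))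
  have hnn : ∀ (j : Fin m) (l : Fin d), 0 ≤ (|v j l| ^ (if k j l then 2 else 0))⁻¹ *
      ((t j.succ - t j.castSucc) ^ (α * ((if k j l then 2 else 0 : ℕ) : ℝ)))⁻¹ := fun j l =>
    mul_nonneg (by positivity) (inv_nonneg.2 (Real.rpow_nonneg (hΔ j).le _))
  refine mul_le_mul (Finset.single_le_sum (fun k _ => (hc0 k).le) (Finset.mem_univ k)) ?_
    (Finset.prod_nonneg fun j _ => Finset.prod_nonneg fun l _ => hnn j l)
    (Finset.sum_nonneg fun k _ => (hc0 k).le)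
  refine Finset.prod_le_prod (fun j _ => Finset.prod_nonneg fun l _ => hnn j l) fun j _ =>
    Finset.prod_le_prod (fun l _ => hnn j l) fun l _ => ?_
  by_cases hk : 1 ≤ ((t j.succ - t j.castSucc) ^ α * v j l) ^ 2
  · have hkt : k j l = true := by simpa [k] using hk
    have hpow : (t j.succ - t j.castSucc) ^ (α * ((2 : ℕ) : ℝ)) =
        ((t j.succ - t j.castSucc) ^ α) ^ 2 := Real.rpow_mul_natCast (hΔ j).le _ _
    simp only [hkt, if_true]
    rw [hpow, sq_abs, ← mul_inv, ← mul_pow, mul_comm (v j l), ← div_eq_mul_inv,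
      inv_eq_one_div, div_le_div_iff₀ (by linarith) (by linarith)]
    linarith
  · have hkf : k j l = false := by simpa [k] using hk
    simp only [hkf, Bool.false_eq_true, if_false]
    have h1 : 1 ≤ 2 * (1 + ((t j.succ - t j.castSucc) ^ α * v j l) ^ 2)⁻¹ := by
      rw [← div_eq_mul_inv, le_div_iff₀ (by positivity)]
      linarith
    simpa using h1

lemma lintegral_prod_coord {d m : ℕ} {a : Fin m → ℝ} (ha : ∀ j, 0 < a j) :
    ∫⁻ v : Fin m → EuclideanSpace ℝ (Fin d),
        ∏ j, ∏ l, ENNReal.ofReal (2 * (1 + (a j * v j l) ^ 2)⁻¹) =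
      ∏ j, ENNReal.ofReal (2 * Real.pi * (a j)⁻¹) ^ d := by
  rw [lintegral_fin_prod (fun j (x : EuclideanSpace ℝ (Fin d)) =>
    ∏ l, ENNReal.ofReal (2 * (1 + (a j * x l) ^ 2)⁻¹)) fun j => by fun_prop]
  refine Finset.prod_congr rfl fun j _ => ?_
  rw [(PiLp.volume_preserving_ofLp (Fin d)).lintegral_comp
    (f := fun x : Fin d → ℝ => ∏ l, ENNReal.ofReal (2 * (1 + (a j * x l) ^ 2)⁻¹)) (by fun_prop),
    lintegral_fin_prod (fun _ (x : ℝ) => ENNReal.ofReal (2 * (1 + (a j * x) ^ 2)⁻¹))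
      fun _ => by fun_prop]
  simp only [lintegral_two_div_one_add_mul_sq (ha j), Finset.prod_const, Finset.card_univ,
    Fintype.card_fin]

/-- The integral of the modulus of the characteristic function of `(Y (s 0), …, Y (s (m - 1)))` is
bounded by negative powers of the increments of the ordered times `s`. -/
lemma IsLND.exists_lintegral_charFun_le {Ω : Type*} [MeasurableSpace Ω] {P : Measure Ω} {d : ℕ}
    {Y : ℝ → Ω → EuclideanSpace ℝ (Fin d)} {T α : ℝ} (hLND : IsLND P d Y T α)
    (hY0 : ∀ᵐ ω ∂P, Y 0 ω = 0) {m : ℕ} (hm : 2 ≤ m) :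
    ∃ K : ℝ, 0 < K ∧ ∀ s : Fin m → ℝ, (∀ j, 0 < s j) → (∀ j, s j ≤ T) → StrictMono s →
      ∫⁻ u : Fin m → EuclideanSpace ℝ (Fin d), ENNReal.ofReal
          ‖∫ ω, Complex.exp (Complex.I * ((∑ j : Fin m, (⟪u j, Y (s j) ω⟫ : ℝ)) : ℂ)) ∂P‖ ≤
        ENNReal.ofReal K * ∏ j, ENNReal.ofReal (permIncr 1 s j ^ (-(α * d))) := by
  obtain ⟨c, hc0, hc⟩ := hLND.exists_bound hm
  obtain ⟨D, hD0, hD⟩ := exists_lintegral_comp_linearMap volume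
    (tailSum (EuclideanSpace ℝ (Fin d)) m) (tailSum_injective _ _)
  refine ⟨c * (D + 1) * ((2 * Real.pi) ^ d) ^ m, by positivity, fun s hs0 hsT hs => ?_⟩
  set t : Fin (m + 1) → ℝ := Fin.cons 0 s with ht
  have htm : StrictMono t := by
    rw [Fin.strictMono_iff_lt_succ]
    intro i
    obtain ⟨n, rfl⟩ : ∃ n, m = n + 1 := ⟨m - 1, by omega⟩
    refine Fin.cases ?_ (fun k => ?_) i
    · simpa [ht] using hs0 0
    · simpa [ht, ← Fin.succ_castSucc] using hs (Fin.castSucc_lt_succ (i := k))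
  have htT : t (Fin.last m) ≤ T := by
    obtain ⟨n, rfl⟩ : ∃ n, m = n + 1 := ⟨m - 1, by omega⟩
    simpa [ht, ← Fin.succ_last] using hsT (Fin.last n)
  have hΔ : ∀ j : Fin m, 0 < t j.succ - t j.castSucc :=
    fun j => sub_pos.2 (htm Fin.castSucc_lt_succ)
  have hae : ∀ᵐ u : Fin m → EuclideanSpace ℝ (Fin d),
      ∀ j l, tailSum (EuclideanSpace ℝ (Fin d)) m u j l ≠ 0 := by
    simp_rw [ae_all_iff]
    intro j l
    let f : (Fin m → EuclideanSpace ℝ (Fin d)) →ₗ[ℝ] ℝ :=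
      (EuclideanSpace.proj l : EuclideanSpace ℝ (Fin d) →L[ℝ] ℝ).toLinearMap ∘ₗ
        LinearMap.proj j ∘ₗ tailSum (EuclideanSpace ℝ (Fin d)) m
    refine ae_linearMap_ne_zero volume f (x := Pi.single j (EuclideanSpace.single l 1)) ?_
    have : tailSum (EuclideanSpace ℝ (Fin d)) m
        (Pi.single j (EuclideanSpace.single l (1 : ℝ))) j = EuclideanSpace.single l 1 := by
      rw [tailSum_apply, Finset.sum_pi_single']
      simp
    simp [f, this]
  let G : (Fin m → EuclideanSpace ℝ (Fin d)) → ℝ≥0∞ := fun v =>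
    ∏ j, ∏ l, ENNReal.ofReal (2 * (1 + ((t j.succ - t j.castSucc) ^ α * v j l) ^ 2)⁻¹)
  have hGm : Measurable G := by fun_prop
  calc _ ≤ ∫⁻ u, ENNReal.ofReal c * G (tailSum (EuclideanSpace ℝ (Fin d)) m u) := by
        refine lintegral_mono_ae ?_
        filter_upwards [hae] with u hu
        have hexp : (∫ ω, Complex.exp (Complex.I *
            ((∑ j : Fin m, (⟪u j, Y (s j) ω⟫ : ℝ)) : ℂ)) ∂P) =
            ∫ ω, Complex.exp (Complex.I * ((∑ j : Fin m,
              (⟪tailSum (EuclideanSpace ℝ (Fin d)) m u j,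
                Y (t j.succ) ω - Y (t j.castSucc) ω⟫ : ℝ)) : ℂ)) ∂P := by
          refine integral_congr_ae ?_
          filter_upwards [hY0] with ω hω
          have := sum_inner_tailSum u (fun j => Y (t j) ω) (by simpa [ht] using hω)
          rw [← Complex.ofReal_sum, ← Complex.ofReal_sum, this]
          simp [ht]
        rw [hexp]
        refine (ENNReal.ofReal_le_ofReal (hc _ hu t rfl htm htT)).trans_eq ?_
        rw [ENNReal.ofReal_mul hc0.le, ENNReal.ofReal_prod_of_nonneg fun j _ =>
          Finset.prod_nonneg fun l _ => by positivity]
        congr 1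
        refine Finset.prod_congr rfl fun j _ => ?_
        rw [ENNReal.ofReal_prod_of_nonneg fun l _ => by positivity]
    _ = ENNReal.ofReal c * (ENNReal.ofReal D *
          ∏ j : Fin m, ENNReal.ofReal (2 * Real.pi * ((t j.succ - t j.castSucc) ^ α)⁻¹) ^ d) := by
        rw [lintegral_const_mul' _ _ ENNReal.ofReal_ne_top, hD G hGm,
          lintegral_prod_coord fun j => Real.rpow_pos_of_pos (hΔ j) α]
    _ ≤ ENNReal.ofReal c * (ENNReal.ofReal (D + 1) *
          ∏ j : Fin m, ENNReal.ofReal (2 * Real.pi * ((t j.succ - t j.castSucc) ^ α)⁻¹) ^ d) := by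
        gcongr
        linarith
    _ = _ := by
        have hfac : ∀ j : Fin m,
            ENNReal.ofReal (2 * Real.pi * ((t j.succ - t j.castSucc) ^ α)⁻¹) ^ d =
              ENNReal.ofReal ((2 * Real.pi) ^ d) *
                ENNReal.ofReal (permIncr 1 s j ^ (-(α * d))) := fun j => by
          have h1 : permIncr 1 s j = t j.succ - t j.castSucc := rfl
          rw [← ENNReal.ofReal_pow (by have := hΔ j; positivity),
            ← ENNReal.ofReal_mul (by positivity), h1, mul_pow, inv_pow,
            Real.rpow_neg (hΔ j).le, Real.rpow_mul_natCast (hΔ j).le]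
        simp_rw [hfac]
        rw [Finset.prod_mul_distrib, Finset.prod_const, Finset.card_univ, Fintype.card_fin,
          ENNReal.ofReal_mul (by positivity), ENNReal.ofReal_mul hc0.le,
          ENNReal.ofReal_pow (by positivity : (0 : ℝ) ≤ (2 * Real.pi) ^ d) m]
        ring

lemma permIncr_eq_permIncr_one {m : ℕ} (σ : Equiv.Perm (Fin m)) (s : Fin m → ℝ) :
    permIncr σ s = permIncr 1 (s ∘ σ) := rfl

/-- Both the sequence `s` and the variables of integration may be permuted. -/
lemma lintegral_charFun_comp_perm {Ω : Type*} [MeasurableSpace Ω] (P : Measure Ω) {d m : ℕ}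
    (Y : ℝ → Ω → EuclideanSpace ℝ (Fin d)) (s : Fin m → ℝ) (σ : Equiv.Perm (Fin m)) :
    ∫⁻ u : Fin m → EuclideanSpace ℝ (Fin d), ENNReal.ofReal
        ‖∫ ω, Complex.exp (Complex.I * ((∑ j : Fin m, (⟪u j, Y (s (σ j)) ω⟫ : ℝ)) : ℂ)) ∂P‖ =
      ∫⁻ u : Fin m → EuclideanSpace ℝ (Fin d), ENNReal.ofReal
        ‖∫ ω, Complex.exp (Complex.I * ((∑ j : Fin m, (⟪u j, Y (s j) ω⟫ : ℝ)) : ℂ)) ∂P‖ := by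
  conv_rhs =>
    rw [← (volume_measurePreserving_piCongrLeft (fun _ : Fin m => EuclideanSpace ℝ (Fin d))
      σ).lintegral_comp_emb (MeasurableEquiv.measurableEmbedding _)]
  refine lintegral_congr fun u => ?_
  congr 3
  ext ω
  conv_rhs => rw [← Equiv.sum_comp σ]
  simp [MeasurableEquiv.coe_piCongrLeft, Equiv.piCongrLeft_apply_apply]

lemma ae_injective_fin (m : ℕ) : ∀ᵐ s : Fin m → ℝ, Function.Injective s := by
  have h : ∀ᵐ s : Fin m → ℝ, ∀ i j, i ≠ j → s i ≠ s j := by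
    simp_rw [ae_all_iff]
    intro i j hij
    let p (k : Fin m) : (Fin m → ℝ) →ₗ[ℝ] ℝ := LinearMap.proj k
    have := ae_linearMap_ne_zero volume (p i - p j) (x := Pi.single i 1) (by simp [p, hij.symm])
    filter_upwards [this] with s hs
    simpa [p, sub_eq_zero] using hs
  filter_upwards [h] with s hs i j hij
  by_contra hne
  exact hs i j hne hij

/-- The increments of ordered times in `(t, t + h]` relative to `t` lie in `(0, h]`, and are at most
the increments relative to `0`. -/
lemma permIncr_sub_mem {m : ℕ} {σ : Equiv.Perm (Fin m)} {s : Fin m → ℝ} {t h : ℝ} (ht : 0 ≤ t)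
    (hs : ∀ j, s j ∈ Ioc t (t + h)) (hσ : StrictMono (s ∘ σ)) (j : Fin m) :
    permIncr σ (fun i => s i - t) j ∈ Ioc 0 h ∧
      permIncr σ (fun i => s i - t) j ≤ permIncr σ s j := by
  have hj := hs (σ j)
  obtain ⟨n, rfl⟩ : ∃ n, m = n + 1 := ⟨m - 1, by have := j.pos; omega⟩
  simp only [permIncr_apply]
  refine Fin.cases ?_ (fun k => ?_) j
  · have := hs (σ 0)
    simp
    grind
  · have h1 := hσ (Fin.castSucc_lt_succ (i := k))
    have h2 := hs (σ k.castSucc)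
    have h3 := hs (σ k.succ)
    simp only [← Fin.succ_castSucc, Fin.cons_succ, Function.comp_apply] at h1 ⊢
    grind

theorem moment_integral_bound_of_LND
    {Ω : Type*} [MeasurableSpace Ω] (P : Measure Ω) [IsProbabilityMeasure P]
    (d : ℕ) (hd1 : 1 ≤ d) (hd3 : d ≤ 3) (T : ℝ) (hT : 0 < T)
    (Y : ℝ → Ω → EuclideanSpace ℝ (Fin d))
    (hmeas : Measurable (Function.uncurry Y))
    (hY0 : ∀ᵐ ω ∂P, Y 0 ω = 0)
    (hLND : IsLND P d Y T (1 / 4)) :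
    ∀ m : ℕ, 2 ≤ m → Even m → ∃ C : ℝ, 0 < C ∧
      ∀ t h : ℝ, 0 ≤ t → 0 < h → t + h ≤ T →
        ∫⁻ s in Set.univ.pi (fun _ : Fin m => Set.Icc t (t + h)),
          ∫⁻ u : Fin m → EuclideanSpace ℝ (Fin d),
            ENNReal.ofReal
              ‖∫ ω, Complex.exp (Complex.I *
                ((∑ j : Fin m, (⟪u j, Y (s j) ω⟫ : ℝ)) : ℂ)) ∂P‖ ∂volume ∂volume ≤
          ENNReal.ofReal (C * h ^ ((m : ℝ) * (1 - d / 4))) := by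
  intro m hm _
  obtain ⟨K, hK0, hK⟩ := hLND.exists_lintegral_charFun_le hY0 hm
  choose c hc0 hc using fun σ : Equiv.Perm (Fin m) =>
    exists_lintegral_comp_linearMap volume (permIncr σ) (permIncr_injective σ)
  have hd : (d : ℝ) ≤ 3 := by exact_mod_cast hd3
  set r : ℝ := -(1 / 4 * d) with hr
  have hr1 : 0 < r + 1 := by linarith
  refine ⟨K * (∑ σ, c σ + 1) * ((r + 1)⁻¹) ^ m, ?_, fun t h ht hh hthT => ?_⟩
  · have := Finset.sum_nonneg fun σ (_ : σ ∈ Finset.univ) => hc0 σ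
    positivity
  let ψ : ℝ → ℝ≥0∞ := (Ioc 0 h).indicator fun x => ENNReal.ofReal (x ^ r)
  have hψ : Measurable ψ := Measurable.indicator (by fun_prop) measurableSet_Ioc
  have hψm : Measurable fun x : Fin m → ℝ => ∏ j, ψ (x j) :=
    Finset.measurable_prod _ fun j _ => hψ.comp (measurable_pi_apply j)
  have hne : ∀ᵐ s : Fin m → ℝ, ∀ j, s j ≠ t := by
    rw [ae_all_iff]
    exact fun j => Measure.ae_eval_ne (fun _ : Fin m => (volume : Measure ℝ)) j t
  calc _ ≤ ∫⁻ s in Set.univ.pi (fun _ : Fin m => Set.Icc t (t + h)),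
          ENNReal.ofReal K * ∑ σ, ∏ j, ψ (permIncr σ (fun i => s i - t) j) := by
        refine lintegral_mono_ae ?_
        filter_upwards [ae_restrict_mem (MeasurableSet.univ_pi fun _ => measurableSet_Icc),
          ae_restrict_of_ae hne, ae_restrict_of_ae (ae_injective_fin m)] with s hs hst hinj
        have hmem : ∀ j, s j ∈ Ioc t (t + h) := fun j =>
          ⟨lt_of_le_of_ne (hs j (mem_univ j)).1 (hst j).symm, (hs j (mem_univ j)).2⟩
        have hσ : StrictMono (s ∘ Tuple.sort s) :=
          (Tuple.monotone_sort s).strictMono_of_injective (hinj.comp (Tuple.sort s).injective)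
        rw [← lintegral_charFun_comp_perm P Y s (Tuple.sort s)]
        refine (hK (s ∘ Tuple.sort s) (fun j => ht.trans_lt (hmem _).1)
          (fun j => (hmem _).2.trans hthT) hσ).trans ?_
        gcongr
        refine le_trans (Finset.prod_le_prod' fun j _ => ?_)
          (Finset.single_le_sum (f := fun σ => ∏ j, ψ (permIncr σ (fun i => s i - t) j))
            (fun σ _ => zero_le) (Finset.mem_univ (Tuple.sort s)))
        obtain ⟨h1, h2⟩ := permIncr_sub_mem ht hmem hσ j
        rw [show ψ _ = _ from indicator_of_mem h1 _, ← permIncr_eq_permIncr_one]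
        exact ENNReal.ofReal_le_ofReal
          (Real.rpow_le_rpow_of_nonpos h1.1 h2 (by rw [hr]; simp))
    _ ≤ ∫⁻ s : Fin m → ℝ,
          ENNReal.ofReal K * ∑ σ, ∏ j, ψ (permIncr σ (fun i => s i - t) j) :=
        setLIntegral_le_lintegral _ _
    _ = ∫⁻ s : Fin m → ℝ, ENNReal.ofReal K * ∑ σ, ∏ j, ψ (permIncr σ s j) :=
        lintegral_sub_right_eq_self
          (fun s : Fin m → ℝ => ENNReal.ofReal K * ∑ σ, ∏ j, ψ (permIncr σ s j)) fun _ => t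
    _ = ENNReal.ofReal K * ∑ σ, ENNReal.ofReal (c σ) *
          ENNReal.ofReal (h ^ (r + 1) / (r + 1)) ^ m := by
        have hint : ∫⁻ x : Fin m → ℝ, ∏ j, ψ (x j) =
            ENNReal.ofReal (h ^ (r + 1) / (r + 1)) ^ m := by
          rw [lintegral_fin_prod (fun _ => ψ) fun _ => hψ]
          simp only [ψ, lintegral_Ioc_rpow (by linarith : -1 < r) hh, Finset.prod_const,
            Finset.card_univ, Fintype.card_fin]
        rw [lintegral_const_mul' _ _ ENNReal.ofReal_ne_top, lintegral_finsetSum]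
        · simp_rw [fun σ => hc σ _ hψm, hint]
        · exact fun σ _ =>
            hψm.comp (permIncr σ).continuous_of_finiteDimensional.measurable
    _ = ENNReal.ofReal (K * (∑ σ, c σ) * ((r + 1)⁻¹) ^ m * h ^ ((m : ℝ) * (1 - d / 4))) := by
        have hpow : h ^ ((m : ℝ) * (1 - d / 4)) = (h ^ (r + 1)) ^ m := by
          rw [← Real.rpow_mul_natCast hh.le, hr]
          ring_nf
        have hsum := Finset.sum_nonneg fun σ (_ : σ ∈ Finset.univ) => hc0 σ
        rw [← Finset.sum_mul, ← ENNReal.ofReal_sum_of_nonneg fun σ _ => hc0 σ,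
          ← ENNReal.ofReal_pow (by positivity), ← ENNReal.ofReal_mul hsum,
          ← ENNReal.ofReal_mul hK0.le, hpow, div_eq_mul_inv, mul_pow]
        ring_nf
    _ ≤ _ := by
        gcongr
        linarith
end
end

section
/- Let α∈(0,1/2] and let Y:[0,T]×Ω→ℝ be a jointly measurable real-valued process with Y_0=0 almost surely, such that for every integer m≥1, all real numbers v_1,…,v_m and all points 0=t_0<t_1<⋯<t_m≤T, the random variable S = ∑_{j=1}^m v_j(Y_{t_j}−Y_{t_{j−1}}) has the centered Gaussian law on ℝ with variance E[S²]. Assume: (i) (local nondeterminism) for every integer m≥2 there exist constants c_m>0 and ε>0 such that for all 0=t_0<t_1<⋯<t_m≤T with t_m−t_1<ε and all reals v_1,…,v_m, Var(∑_{j=1}^m v_j(Y_{t_j}−Y_{t_{j−1}})) ≥ c_m ∑_{j=1}^m v_j² Var(Y_{t_j}−Y_{t_{j−1}}); (ii) there exists K>0 such that Var(Y_t−Y_s) ≥ K(t−s)^{2α} for all 0≤s<t≤T. Then Y is α-LND on [0,T] in the local sense: for every integer m≥2 and all nonnegative integers k_1,…,k_m there exist constants c>0 and ε>0 such that for all 0=t_0<t_1<⋯<t_m≤T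 with t_m−t_1<ε and all nonzero reals v_1,…,v_m, |E[exp(i∑_{j=1}^m v_j(Y_{t_j}−Y_{t_{j−1}}))]| ≤ c·∏_{j=1}^m |v_j|^{−k_j}(t_j−t_{j−1})^{−αk_j}. -/
open MeasureTheory Filter Set ProbabilityTheory
open scoped ENNReal NNReal

noncomputable section

/-- A polynomial is dominated by a Gaussian weight, with an explicit constant. -/
lemma pow_le_one_add_factorial_div_mul_exp {a : ℝ} (ha : 0 < a) (x : ℝ) (k : ℕ) :
    x ^ k ≤ (1 + k.factorial / a ^ k) * Real.exp (a * x ^ 2) := by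
  have hax : 0 ≤ a * x ^ 2 := by positivity
  have hone : 1 ≤ Real.exp (a * x ^ 2) := Real.one_le_exp hax
  have hpow : (x ^ k) ^ 2 ≤ k.factorial / a ^ k * Real.exp (a * x ^ 2) := by
    calc (x ^ k) ^ 2 = k.factorial / a ^ k * ((a * x ^ 2) ^ k / k.factorial) := by
          rw [mul_pow]; field_simp; ring
      _ ≤ _ := by gcongr; exact Real.pow_div_factorial_le_exp _ hax k
  nlinarith [sq_nonneg (x ^ k - 1)]

/-- Gaussian decay beats every product of inverse powers. -/
lemma exp_neg_mul_sum_sq_le_prod {ι : Type*} [Fintype ι] {a : ℝ} (ha : 0 < a) (k : ι → ℕ)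
    {x : ι → ℝ} (hx : ∀ j, 0 < x j) :
    Real.exp (-(a * ∑ j, x j ^ 2)) ≤
      (∏ j, (1 + (k j).factorial / a ^ k j)) * ∏ j, (x j ^ k j)⁻¹ := by
  rw [Finset.mul_sum, ← Finset.sum_neg_distrib, Real.exp_sum, ← Finset.prod_mul_distrib]
  refine Finset.prod_le_prod (fun j _ => (Real.exp_pos _).le) fun j _ => ?_
  have hxk : 0 < x j ^ k j := pow_pos (hx j) _
  rw [Real.exp_neg, ← div_eq_mul_inv, le_div_iff₀ hxk, inv_mul_le_iff₀ (Real.exp_pos _),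
    mul_comm]
  exact pow_le_one_add_factorial_div_mul_exp ha (x j) (k j)

/-- The characteristic function at `1` of a centered Gaussian variable, in terms of its
variance. -/
lemma norm_integral_cexp_I_mul_of_map_eq_gaussianReal {Ω : Type*} [MeasurableSpace Ω]
    {P : Measure Ω} {S : Ω → ℝ} {σ : ℝ≥0} (hS : AEMeasurable S P)
    (hlaw : Measure.map S P = gaussianReal 0 σ) :
    ‖∫ ω, Complex.exp (Complex.I * (S ω : ℂ)) ∂P‖ = Real.exp (-(variance S P / 2)) := by
  have hvar : variance S P = σ := by
    rw [← variance_id_map hS, hlaw, variance_id_gaussianReal]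
  have hint : ∫ ω, Complex.exp (Complex.I * (S ω : ℂ)) ∂P =
      charFun (Measure.map S P) 1 := by
    rw [charFun_apply_real, integral_map hS (by fun_prop)]
    simp [mul_comm]
  rw [hint, hlaw, charFun_gaussianReal, hvar, Complex.norm_exp]
  simp

/-- Let `α ∈ (0,1/2]` and `Y` be a real-valued Gaussian-type process on `[0,T]` with
`Y_0 = 0` a.s., whose increment combinations `∑_j v_j (Y_{t_j} − Y_{t_{j−1}})` are
centered Gaussian. Assume the classical local nondeterminism inequality and a lower bound
`Var(Y_t − Y_s) ≥ K (t−s)^{2α}`. Then `Y` is `α`-LND on `[0,T]` in the local sense. -/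
theorem gaussian_LND_of_classical_LND
    {Ω : Type*} [MeasurableSpace Ω] (P : Measure Ω) [IsProbabilityMeasure P]
    (T : ℝ) (hT : 0 < T) (α : ℝ) (hα0 : 0 < α) (hα : α ≤ 1 / 2)
    (Y : ℝ → Ω → ℝ)
    (hmeas : Measurable (Function.uncurry Y))
    (hY0 : ∀ᵐ ω ∂P, Y 0 ω = 0)
    (hGauss : ∀ m : ℕ, 1 ≤ m → ∀ v : Fin m → ℝ, ∀ t : Fin (m + 1) → ℝ,
      t 0 = 0 → StrictMono t → t (Fin.last m) ≤ T →
        Measure.map (fun ω => ∑ j : Fin m, v j * (Y (t j.succ) ω - Y (t j.castSucc) ω)) P =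
          gaussianReal 0
            (Real.toNNReal
              (∫ ω, (∑ j : Fin m, v j * (Y (t j.succ) ω - Y (t j.castSucc) ω)) ^ 2 ∂P)))
    (hLNDvar : ∀ m : ℕ, 2 ≤ m → ∃ c : ℝ, 0 < c ∧ ∃ ε : ℝ, 0 < ε ∧
      ∀ t : Fin (m + 1) → ℝ, t 0 = 0 → StrictMono t → t (Fin.last m) ≤ T →
        t (Fin.last m) - t 1 < ε → ∀ v : Fin m → ℝ,
          c * ∑ j : Fin m, (v j) ^ 2 *
              variance (fun ω => Y (t j.succ) ω - Y (t j.castSucc) ω) P ≤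
            variance (fun ω => ∑ j : Fin m, v j * (Y (t j.succ) ω - Y (t j.castSucc) ω)) P)
    (hvar : ∃ K : ℝ, 0 < K ∧ ∀ s t : ℝ, 0 ≤ s → s < t → t ≤ T →
      K * (t - s) ^ (2 * α) ≤ variance (fun ω => Y t ω - Y s ω) P) :
    ∀ m : ℕ, 2 ≤ m → ∀ k : Fin m → ℕ, ∃ c : ℝ, 0 < c ∧ ∃ ε : ℝ, 0 < ε ∧
      ∀ t : Fin (m + 1) → ℝ, t 0 = 0 → StrictMono t → t (Fin.last m) ≤ T →
        t (Fin.last m) - t 1 < ε → ∀ v : Fin m → ℝ, (∀ j, v j ≠ 0) →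
          ‖∫ ω, Complex.exp (Complex.I *
              ((∑ j : Fin m, v j * (Y (t j.succ) ω - Y (t j.castSucc) ω) : ℝ) : ℂ)) ∂P‖ ≤
            c * ∏ j : Fin m,
              (|v j| ^ k j)⁻¹ * ((t j.succ - t j.castSucc) ^ (α * (k j : ℝ)))⁻¹ := by
  intro m hm k
  obtain ⟨c, hc, ε, hε, hLND⟩ := hLNDvar m hm
  obtain ⟨K, hK, hvarK⟩ := hvar
  have ha : 0 < c * K / 2 := by positivity
  refine ⟨∏ j, (1 + (k j).factorial / (c * K / 2) ^ k j),
    Finset.prod_pos fun j _ => by positivity, ε, hε, fun t ht0 htmono htT hdiam v hv => ?_⟩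
  have hYm : ∀ s, Measurable (Y s) := fun s => hmeas.of_uncurry_left
  have hS : Measurable
      fun ω => ∑ j : Fin m, v j * (Y (t j.succ) ω - Y (t j.castSucc) ω) :=
    Finset.measurable_sum _ fun j _ => ((hYm _).sub (hYm _)).const_mul _
  rw [norm_integral_cexp_I_mul_of_map_eq_gaussianReal hS.aemeasurable
    (hGauss m (by lia) v t ht0 htmono htT)]
  have hΔ : ∀ j : Fin m, 0 < t j.succ - t j.castSucc := fun j =>
    sub_pos.2 (htmono j.castSucc_lt_succ)
  have hsq : ∀ j : Fin m, (|v j| * (t j.succ - t j.castSucc) ^ α) ^ 2 =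
      v j ^ 2 * (t j.succ - t j.castSucc) ^ (2 * α) := fun j => by
    rw [mul_pow, sq_abs, mul_comm 2 α, ← Real.rpow_mul_natCast (hΔ j).le α 2, Nat.cast_ofNat]
  have hlow : c * K * ∑ j : Fin m, (|v j| * (t j.succ - t j.castSucc) ^ α) ^ 2 ≤
      variance (fun ω => ∑ j : Fin m, v j * (Y (t j.succ) ω - Y (t j.castSucc) ω)) P := by
    refine le_trans ?_ (hLND t ht0 htmono htT hdiam v)
    rw [mul_assoc]
    refine mul_le_mul_of_nonneg_left ((Finset.mul_sum _ _ _).trans_le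
      (Finset.sum_le_sum fun j _ => ?_)) hc.le
    rw [hsq, mul_left_comm]
    refine mul_le_mul_of_nonneg_left ?_ (sq_nonneg _)
    refine hvarK _ _ ?_ (htmono j.castSucc_lt_succ) ((htmono.monotone (Fin.le_last _)).trans htT)
    rw [← ht0]
    exact htmono.monotone (Fin.zero_le _)
  calc _ ≤ Real.exp (-(c * K / 2 *
        ∑ j : Fin m, (|v j| * (t j.succ - t j.castSucc) ^ α) ^ 2)) :=
        Real.exp_le_exp.2 (by linarith)
    _ ≤ _ := exp_neg_mul_sum_sq_le_prod ha k fun j =>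
        mul_pos (abs_pos.2 (hv j)) (Real.rpow_pos_of_pos (hΔ j) α)
    _ = _ := by
        congr 1
        refine Finset.prod_congr rfl fun j _ => ?_
        rw [mul_pow, mul_inv, Real.rpow_mul_natCast (hΔ j).le]
end
end

section
/- (Geman–Horowitz) Let X:[0,T]×Ω→ℝ^d be a jointly measurable process and let t∈(0,T]. Then the following are equivalent: (a) there exists a jointly measurable function L:ℝ^d×Ω→[0,∞) such that almost surely L(·,ω) is a Lebesgue density of the occupation measure of s↦X_s(ω) on [0,t], and E[∫_{ℝ^d} L(x)² dx] < ∞; (b) liminf_{ε→0⁺} ε^{−d} ∫_0^t ∫_0^t P(‖X_s−X_r‖ ≤ ε) dr ds < ∞. -/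
open MeasureTheory Filter Set
open scoped ENNReal NNReal

noncomputable section

section Differentiation

variable {E : Type*} [NormedAddCommGroup E] [NormedSpace ℝ E] [FiniteDimensional ℝ E]
  [MeasurableSpace E] [BorelSpace E]

/-- The lower derivative of `μ` with respect to `ν`, along balls whose radii are `ε n`. -/
def lowerBallDensity (μ ν : Measure E) (ε : ℕ → ℝ) (x : E) : ℝ≥0∞ :=
  liminf (fun n => μ (Metric.closedBall x (ε n)) / ν (Metric.closedBall x (ε n))) atTop

lemma lowerBallDensity_ae_eq_rnDeriv (μ ν : Measure E) [IsLocallyFiniteMeasure μ]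
    [IsLocallyFiniteMeasure ν] {ε : ℕ → ℝ} (hε : Tendsto ε atTop (nhdsWithin 0 (Ioi 0))) :
    lowerBallDensity μ ν ε =ᵐ[ν] μ.rnDeriv ν := by
  have : ProperSpace E := FiniteDimensional.proper_real E
  have : SecondCountableTopology E := secondCountable_of_proper
  filter_upwards [Besicovitch.ae_tendsto_rnDeriv μ ν] with x hx
  exact (hx.comp hε).liminf_eq

/-- A measure whose lower ball density with respect to `ν` is finite almost everywhere (for the
measure itself) is absolutely continuous with respect to `ν`. -/
lemma absolutelyContinuous_of_lowerBallDensity_lt_top (μ ν : Measure E)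
    [IsLocallyFiniteMeasure μ] [IsLocallyFiniteMeasure ν] [ν.IsOpenPosMeasure]
    {ε : ℕ → ℝ} (hε : Tendsto ε atTop (nhdsWithin 0 (Ioi 0)))
    (h : ∀ᵐ x ∂μ, lowerBallDensity μ ν ε x < ⊤) : μ ≪ ν := by
  have : ProperSpace E := FiniteDimensional.proper_real E
  have : SecondCountableTopology E := secondCountable_of_proper
  have hne : ∀ᵐ x ∂μ, ν.rnDeriv μ x ≠ 0 := by
    filter_upwards [Besicovitch.ae_tendsto_rnDeriv ν μ, h] with x hx hfin h0
    rw [h0] at hx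
    have hinv := tendsto_inv_iff.2 (hx.comp hε)
    rw [ENNReal.inv_zero] at hinv
    have hpos : ∀ᶠ n in atTop, 0 < ε n := hε.eventually self_mem_nhdsWithin
    have hdiv : Tendsto
        (fun n => μ (Metric.closedBall x (ε n)) / ν (Metric.closedBall x (ε n))) atTop
        (nhds ⊤) := by
      refine hinv.congr' ?_
      filter_upwards [hpos] with n hn
      exact ENNReal.inv_div (Or.inr (isCompact_closedBall x _).measure_lt_top.ne)
        (Or.inr (Metric.measure_closedBall_pos ν x hn).ne')
    exact hfin.ne hdiv.liminf_eq
  exact (withDensity_absolutelyContinuous' (Measure.measurable_rnDeriv ν μ).aemeasurable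
    hne).trans (Measure.withDensity_rnDeriv_le ν μ).absolutelyContinuous

/-- If the lower ball density is integrable against the measure itself, it is a finite density,
and its square integral is its integral against the measure. -/
lemma density_of_lintegral_lowerBallDensity_lt_top (μ ν : Measure E) [IsFiniteMeasure μ]
    [IsLocallyFiniteMeasure ν] [ν.IsOpenPosMeasure]
    {ε : ℕ → ℝ} (hε : Tendsto ε atTop (nhdsWithin 0 (Ioi 0)))
    (hmeas : Measurable (lowerBallDensity μ ν ε))
    (h : ∫⁻ x, lowerBallDensity μ ν ε x ∂μ < ⊤) :
    μ = ν.withDensity (fun x => ENNReal.ofReal (lowerBallDensity μ ν ε x).toReal) ∧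
    ∫⁻ x, ENNReal.ofReal ((lowerBallDensity μ ν ε x).toReal ^ 2) ∂ν =
      ∫⁻ x, lowerBallDensity μ ν ε x ∂μ := by
  have : ProperSpace E := FiniteDimensional.proper_real E
  have : SecondCountableTopology E := secondCountable_of_proper
  have hac := absolutelyContinuous_of_lowerBallDensity_lt_top μ ν hε (ae_lt_top hmeas h.ne)
  have hae := lowerBallDensity_ae_eq_rnDeriv μ ν hε
  have hofReal : ∀ᵐ x ∂ν, ENNReal.ofReal (lowerBallDensity μ ν ε x).toReal =
      lowerBallDensity μ ν ε x := by
    filter_upwards [hae, Measure.rnDeriv_lt_top μ ν] with x hx hlt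
    exact ENNReal.ofReal_toReal (hx ▸ hlt.ne)
  have hμ : μ = ν.withDensity (lowerBallDensity μ ν ε) := by
    rw [withDensity_congr_ae hae, Measure.withDensity_rnDeriv_eq μ ν hac]
  refine ⟨by rw [withDensity_congr_ae hofReal, ← hμ], ?_⟩
  calc ∫⁻ x, ENNReal.ofReal ((lowerBallDensity μ ν ε x).toReal ^ 2) ∂ν
      = ∫⁻ x, lowerBallDensity μ ν ε x * lowerBallDensity μ ν ε x ∂ν := by
        refine lintegral_congr_ae ?_
        filter_upwards [hofReal] with x hx
        rw [ENNReal.ofReal_pow ENNReal.toReal_nonneg, hx, sq]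
    _ = ∫⁻ x, lowerBallDensity μ ν ε x ∂(ν.withDensity (lowerBallDensity μ ν ε)) := by
        rw [lintegral_withDensity_eq_lintegral_mul _ hmeas hmeas]; rfl
    _ = _ := by rw [← hμ]

lemma lintegral_withDensity_closedBall_le (ν : Measure E) [ν.IsAddHaarMeasure] {f : E → ℝ≥0∞}
    (hf : Measurable f) (r : ℝ) :
    ∫⁻ x, ν.withDensity f (Metric.closedBall x r) ∂(ν.withDensity f) ≤
      2 * ν (Metric.closedBall 0 r) * ∫⁻ x, f x ^ 2 ∂ν := by
  have : ProperSpace E := FiniteDimensional.proper_real E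
  have : SecondCountableTopology E := secondCountable_of_proper
  have hS : MeasurableSet {p : E × E | dist p.2 p.1 ≤ r} :=
    measurableSet_le (measurable_snd.dist measurable_fst) measurable_const
  have hball (x : E) : ν (Metric.closedBall x r) = ν (Metric.closedBall 0 r) :=
    Measure.addHaar_closedBall_center ν x r
  set S := {p : E × E | dist p.2 p.1 ≤ r}
  have hind : Measurable (S.indicator (1 : E × E → ℝ≥0∞)) := measurable_one.indicator hS
  have hleft (x : E) : Measurable fun y => S.indicator (1 : E × E → ℝ≥0∞) (x, y) :=
    hind.comp measurable_prodMk_left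
  have hright (y : E) : Measurable fun x => S.indicator (1 : E × E → ℝ≥0∞) (x, y) :=
    hind.comp measurable_prodMk_right
  have hx (x : E) : ∫⁻ y, S.indicator (1 : E × E → ℝ≥0∞) (x, y) ∂ν =
      ν (Metric.closedBall 0 r) := by
    rw [← hball x, ← lintegral_indicator_one measurableSet_closedBall]
    rfl
  have hy (y : E) : ∫⁻ x, S.indicator (1 : E × E → ℝ≥0∞) (x, y) ∂ν =
      ν (Metric.closedBall 0 r) := by
    rw [← hball y, ← lintegral_indicator_one measurableSet_closedBall]
    refine lintegral_congr fun x => ?_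
    simp [S, indicator, dist_comm]
  have hmul (a b : ℝ≥0∞) : a * b ≤ a ^ 2 + b ^ 2 := by
    rcases le_total a b with h | h
    · calc a * b ≤ b * b := by gcongr
        _ ≤ _ := by rw [← sq]; exact le_add_self
    · calc a * b ≤ a * a := by gcongr
        _ ≤ _ := by rw [← sq]; exact le_self_add
  have hdens (x : E) : ν.withDensity f (Metric.closedBall x r) =
      ∫⁻ y, S.indicator 1 (x, y) * f y ∂ν := by
    rw [withDensity_apply _ measurableSet_closedBall,
      ← lintegral_indicator measurableSet_closedBall]
    refine lintegral_congr fun y => ?_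
    by_cases h : dist y x ≤ r <;> simp [S, indicator, h]
  have hdens_meas : Measurable fun x => ν.withDensity f (Metric.closedBall x r) := by
    simp_rw [hdens]
    exact (hind.mul (hf.comp measurable_snd)).lintegral_prod_right'
  calc ∫⁻ x, ν.withDensity f (Metric.closedBall x r) ∂(ν.withDensity f)
      = ∫⁻ x, f x * ∫⁻ y, S.indicator 1 (x, y) * f y ∂ν ∂ν := by
        rw [lintegral_withDensity_eq_lintegral_mul _ hf hdens_meas]
        simp_rw [Pi.mul_apply, hdens]
    _ = ∫⁻ x, ∫⁻ y, S.indicator 1 (x, y) * (f x * f y) ∂ν ∂ν := by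
        refine lintegral_congr fun x => ?_
        have hxf : Measurable fun y => S.indicator 1 (x, y) * f y := (hleft x).mul hf
        rw [← lintegral_const_mul _ hxf]
        exact lintegral_congr fun y => by ring
    _ ≤ ∫⁻ x, ∫⁻ y, S.indicator 1 (x, y) * f x ^ 2 + S.indicator 1 (x, y) * f y ^ 2 ∂ν ∂ν := by
        gcongr with x y
        rw [← mul_add]
        gcongr
        exact hmul _ _
    _ = ∫⁻ x, ∫⁻ y, S.indicator 1 (x, y) * f x ^ 2 ∂ν ∂ν +
          ∫⁻ x, ∫⁻ y, S.indicator 1 (x, y) * f y ^ 2 ∂ν ∂ν := by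
        rw [← lintegral_add_left]
        · refine lintegral_congr fun x => ?_
          rw [lintegral_add_left]
          exact (hleft x).mul_const _
        · exact (hind.mul ((hf.pow_const 2).comp measurable_fst)).lintegral_prod_right'
    _ = ∫⁻ x, ν (Metric.closedBall 0 r) * f x ^ 2 ∂ν +
          ∫⁻ y, ν (Metric.closedBall 0 r) * f y ^ 2 ∂ν := by
        congr 1
        · refine lintegral_congr fun x => ?_
          rw [lintegral_mul_const _ (hleft x), hx]
        · rw [lintegral_lintegral_swap
            (hind.mul ((hf.pow_const 2).comp measurable_snd)).aemeasurable]
          refine lintegral_congr fun y => ?_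
          rw [lintegral_mul_const _ (hright y), hy]
    _ = _ := by
        rw [lintegral_const_mul _ (hf.pow_const 2)]
        ring

end Differentiation

section Occupation

lemma measurable_lintegral_occupation {Ω E : Type*} [MeasurableSpace Ω] [MeasurableSpace E]
    {X : ℝ → Ω → E} (m : Measure ℝ) [SFinite m] (hX : Measurable (Function.uncurry X)) {f : E × Ω → ℝ≥0∞} (hf : Measurable f) :
    Measurable fun ω => ∫⁻ x, f (x, ω) ∂(m.map (fun s => X s ω)) := by
  have h (ω : Ω) : ∫⁻ x, f (x, ω) ∂(m.map (fun s => X s ω)) = ∫⁻ s, f (X s ω, ω) ∂m :=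
    lintegral_map (hf.comp measurable_prodMk_right) hX.of_uncurry_right
  simp_rw [h]
  exact Measurable.lintegral_prod_left' (f := fun p : ℝ × Ω => f (X p.1 p.2, p.2))
    (hf.comp (hX.prodMk measurable_snd))

variable {Ω E : Type*} [MeasurableSpace Ω] [NormedAddCommGroup E] [MeasurableSpace E]
  [BorelSpace E] [SecondCountableTopology E] {X : ℝ → Ω → E}

lemma measurable_occupation_closedBall (m : Measure ℝ) [SFinite m]
    (hX : Measurable (Function.uncurry X)) (r : ℝ) :
    Measurable fun p : E × Ω => m.map (fun s => X s p.2) (Metric.closedBall p.1 r) := by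
  have hS : MeasurableSet {q : (E × Ω) × ℝ | dist (X q.2 q.1.2) q.1.1 ≤ r} := by
    refine measurableSet_le (Measurable.dist ?_ ?_) measurable_const
    · exact hX.comp (measurable_snd.prodMk (measurable_snd.comp measurable_fst))
    · exact measurable_fst.comp measurable_fst
  convert measurable_measure_prodMk_left (ν := m) hS with p
  rw [Measure.map_apply hX.of_uncurry_right measurableSet_closedBall]
  rfl

lemma lintegral_lintegral_measure_norm_sub_le (P : Measure Ω) [SFinite P]
    (m : Measure ℝ) [SFinite m] (hX : Measurable (Function.uncurry X)) (r : ℝ) :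
    ∫⁻ s, ∫⁻ u, P {ω | ‖X s ω - X u ω‖ ≤ r} ∂m ∂m =
      ∫⁻ ω, ∫⁻ x, m.map (fun s => X s ω) (Metric.closedBall x r)
        ∂(m.map (fun s => X s ω)) ∂P := by
  have hS : MeasurableSet {q : (ℝ × ℝ) × Ω | ‖X q.1.1 q.2 - X q.1.2 q.2‖ ≤ r} := by
    refine measurableSet_le (Measurable.norm (Measurable.sub ?_ ?_)) measurable_const
    · exact hX.comp ((measurable_fst.comp measurable_fst).prodMk measurable_snd)
    · exact hX.comp ((measurable_snd.comp measurable_fst).prodMk measurable_snd)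
  calc ∫⁻ s, ∫⁻ u, P {ω | ‖X s ω - X u ω‖ ≤ r} ∂m ∂m
      = ((m.prod m).prod P) {q : (ℝ × ℝ) × Ω | ‖X q.1.1 q.2 - X q.1.2 q.2‖ ≤ r} := by
        rw [Measure.prod_apply hS,
          lintegral_prod _ (measurable_measure_prodMk_left hS).aemeasurable]
        rfl
    _ = ∫⁻ ω, (m.prod m) {p | ‖X p.1 ω - X p.2 ω‖ ≤ r} ∂P := Measure.prod_apply_symm hS
    _ = _ := by
        refine lintegral_congr fun ω => ?_
        have hω : Measurable fun s => X s ω := hX.of_uncurry_right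
        have hball : Measurable fun x => m.map (fun s => X s ω) (Metric.closedBall x r) :=
          (measurable_occupation_closedBall m hX r).comp measurable_prodMk_right
        have hSω : MeasurableSet {p : ℝ × ℝ | ‖X p.1 ω - X p.2 ω‖ ≤ r} :=
          hS.preimage measurable_prodMk_right
        rw [Measure.prod_apply hSω, lintegral_map hball hω]
        refine lintegral_congr fun s => ?_
        rw [Measure.map_apply hω measurableSet_closedBall]
        congr 1
        ext u
        simp [dist_eq_norm, norm_sub_rev]

/-- If the ball averages of the occupation measures along radii `ε n → 0` are bounded in mean, then
the occupation measures have a jointly measurable density whose square is integrable. -/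
lemma exists_density_of_lintegral_closedBall_le [NormedSpace ℝ E] [FiniteDimensional ℝ E]
    (P : Measure Ω) (m : Measure ℝ) [IsFiniteMeasure m] (hX : Measurable (Function.uncurry X))
    (ν : Measure E) [ν.IsAddHaarMeasure] {ε : ℕ → ℝ}
    (hε : Tendsto ε atTop (nhdsWithin 0 (Ioi 0))) {C : ℝ≥0∞} (hC : C ≠ ⊤)
    (h : ∀ n, ∫⁻ ω, ∫⁻ x, m.map (fun s => X s ω) (Metric.closedBall x (ε n)) /
      ν (Metric.closedBall x (ε n)) ∂(m.map (fun s => X s ω)) ∂P ≤ C) :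
    ∃ L : E → Ω → ℝ, Measurable (Function.uncurry L) ∧ (∀ x ω, 0 ≤ L x ω) ∧
      (∀ᵐ ω ∂P, m.map (fun s => X s ω) = ν.withDensity fun x => ENNReal.ofReal (L x ω)) ∧
      ∫⁻ ω, ∫⁻ x, ENNReal.ofReal ((L x ω) ^ 2) ∂ν ∂P < ⊤ := by
  have : ProperSpace E := FiniteDimensional.proper_real E
  let g (n : ℕ) (p : E × Ω) : ℝ≥0∞ :=
    m.map (fun s => X s p.2) (Metric.closedBall p.1 (ε n)) / ν (Metric.closedBall p.1 (ε n))
  have hg (n : ℕ) : Measurable (g n) := by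
    simp_rw [g, Measure.addHaar_closedBall_center]
    exact (measurable_occupation_closedBall m hX (ε n)).div_const _
  let D (ω : Ω) : E → ℝ≥0∞ := lowerBallDensity (m.map (fun s => X s ω)) ν ε
  have hD : Measurable fun p : E × Ω => D p.2 p.1 := Measurable.liminf hg
  have hDω (ω : Ω) : Measurable (D ω) :=
    Measurable.liminf fun n => (hg n).comp measurable_prodMk_right
  have hDint : ∫⁻ ω, ∫⁻ x, D ω x ∂(m.map (fun s => X s ω)) ∂P < ⊤ := by
    calc ∫⁻ ω, ∫⁻ x, D ω x ∂(m.map (fun s => X s ω)) ∂P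
        ≤ ∫⁻ ω, liminf (fun n => ∫⁻ x, g n (x, ω) ∂(m.map (fun s => X s ω))) atTop ∂P :=
          lintegral_mono fun ω =>
            lintegral_liminf_le fun n => (hg n).comp measurable_prodMk_right
      _ ≤ liminf (fun n => ∫⁻ ω, ∫⁻ x, g n (x, ω) ∂(m.map (fun s => X s ω)) ∂P) atTop :=
          lintegral_liminf_le fun n => measurable_lintegral_occupation m hX (hg n)
      _ ≤ C := liminf_le_of_frequently_le' (Frequently.of_forall h)
      _ < ⊤ := hC.lt_top
  have hdens : ∀ᵐ ω ∂P,
      m.map (fun s => X s ω) = ν.withDensity (fun x => ENNReal.ofReal (D ω x).toReal) ∧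
      ∫⁻ x, ENNReal.ofReal ((D ω x).toReal ^ 2) ∂ν = ∫⁻ x, D ω x ∂(m.map (fun s => X s ω)) := by
    have hmeas : Measurable fun ω => ∫⁻ x, D ω x ∂(m.map (fun s => X s ω)) :=
      measurable_lintegral_occupation m hX hD
    filter_upwards [ae_lt_top hmeas hDint.ne] with ω hω
    exact density_of_lintegral_lowerBallDensity_lt_top _ ν hε (hDω ω) hω
  refine ⟨fun x ω => (D ω x).toReal, hD.ennreal_toReal, fun _ _ => ENNReal.toReal_nonneg,
    hdens.mono fun ω hω => hω.1, ?_⟩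
  rwa [lintegral_congr_ae (hdens.mono fun ω hω => hω.2)]

end Occupation

theorem geman_horowitz_square_integrable_local_time_iff
    {Ω : Type*} [MeasurableSpace Ω] (P : Measure Ω) [IsProbabilityMeasure P]
    (d : ℕ) (hd : 1 ≤ d) (T : ℝ) (hT : 0 < T)
    (X : ℝ → Ω → EuclideanSpace ℝ (Fin d))
    (hmeas : Measurable (Function.uncurry X))
    (t : ℝ) (ht : 0 < t) (htT : t ≤ T) :
    (∃ L : EuclideanSpace ℝ (Fin d) → Ω → ℝ,
        Measurable (Function.uncurry L) ∧ (∀ x ω, 0 ≤ L x ω) ∧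
        (∀ᵐ ω ∂P,
          Measure.map (fun s => X s ω) (volume.restrict (Set.Icc 0 t)) =
            volume.withDensity (fun x => ENNReal.ofReal (L x ω))) ∧
        ∫⁻ ω, ∫⁻ x, ENNReal.ofReal ((L x ω) ^ 2) ∂volume ∂P < ⊤) ↔
      Filter.liminf (fun ε : ℝ =>
        ENNReal.ofReal (ε ^ (-(d : ℝ))) *
          ∫⁻ s in Set.Icc (0 : ℝ) t, ∫⁻ r in Set.Icc (0 : ℝ) t,
            P {ω | ‖X s ω - X r ω‖ ≤ ε} ∂volume ∂volume)
        (nhdsWithin 0 (Set.Ioi 0)) < ⊤ := by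
  set m : Measure ℝ := volume.restrict (Set.Icc 0 t) with hm
  set c : ℝ≥0∞ := volume (Metric.ball (0 : EuclideanSpace ℝ (Fin d)) 1) with hc
  have hc0 : c ≠ 0 := (Metric.measure_ball_pos volume _ one_pos).ne'
  have hctop : c ≠ ⊤ := measure_ball_lt_top.ne
  have hvol (x : EuclideanSpace ℝ (Fin d)) {ε : ℝ} (hε : 0 < ε) :
      volume (Metric.closedBall x ε) = ENNReal.ofReal (ε ^ d) * c := by
    rw [Measure.addHaar_closedBall _ _ hε.le, finrank_euclideanSpace_fin]
  have hrpow {ε : ℝ} (hε : 0 < ε) :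
      ENNReal.ofReal (ε ^ (-(d : ℝ))) = (ENNReal.ofReal (ε ^ d))⁻¹ := by
    rw [Real.rpow_neg hε.le, Real.rpow_natCast, ENNReal.ofReal_inv_of_pos (pow_pos hε d)]
  simp_rw [lintegral_lintegral_measure_norm_sub_le P m hmeas]
  constructor
  · rintro ⟨L, hL, hL0, hmap, hint⟩
    set K := ∫⁻ ω, ∫⁻ x, ENNReal.ofReal ((L x ω) ^ 2) ∂volume ∂P with hK
    have hbound : ∀ᶠ ε : ℝ in nhdsWithin 0 (Ioi 0), ENNReal.ofReal (ε ^ (-(d : ℝ))) *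
        ∫⁻ ω, ∫⁻ x, m.map (fun s => X s ω) (Metric.closedBall x ε)
          ∂(m.map (fun s => X s ω)) ∂P ≤ 2 * c * K := by
      filter_upwards [self_mem_nhdsWithin] with ε hε
      have hε : 0 < ε := hε
      have hpow : ENNReal.ofReal (ε ^ d) ≠ 0 := by simpa using pow_pos hε d
      calc _ ≤ ENNReal.ofReal (ε ^ (-(d : ℝ))) * ∫⁻ ω, 2 * (ENNReal.ofReal (ε ^ d) * c) *
            ∫⁻ x, ENNReal.ofReal ((L x ω) ^ 2) ∂volume ∂P := by
            refine mul_le_mul_right (lintegral_mono_ae ?_) _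
            filter_upwards [hmap] with ω hω
            have hLω : Measurable fun x => ENNReal.ofReal (L x ω) :=
              (hL.comp measurable_prodMk_right).ennreal_ofReal
            rw [hω, ← hvol 0 hε]
            simpa only [ENNReal.ofReal_pow (hL0 _ ω)] using
              lintegral_withDensity_closedBall_le volume hLω ε
        _ = (ENNReal.ofReal (ε ^ d))⁻¹ * ENNReal.ofReal (ε ^ d) * (2 * c * K) := by
            rw [lintegral_const_mul' _ _ (by finiteness), hrpow hε]
            ring
        _ = 2 * c * K := by
            rw [ENNReal.inv_mul_cancel hpow ENNReal.ofReal_ne_top, one_mul]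
    calc _ ≤ 2 * c * K := liminf_le_of_frequently_le' hbound.frequently
      _ < ⊤ := by finiteness
  · intro h
    obtain ⟨C, hC, hCtop⟩ := exists_between h
    obtain ⟨ε, hε, hεC⟩ := exists_seq_forall_of_frequently
      ((frequently_lt_of_liminf_lt (by isBoundedDefault) hC).and_eventually self_mem_nhdsWithin)
    have hinv : c⁻¹ ≠ ⊤ := ENNReal.inv_ne_top.2 hc0
    refine exists_density_of_lintegral_closedBall_le P m hmeas volume hε
      (ENNReal.mul_ne_top hinv hCtop.ne) fun n => ?_
    obtain ⟨hlt, hpos⟩ := hεC n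
    have hpos : 0 < ε n := hpos
    have hpow : ENNReal.ofReal (ε n ^ d) ≠ 0 := by simpa using pow_pos hpos d
    have hfin : c⁻¹ * (ENNReal.ofReal (ε n ^ d))⁻¹ ≠ ⊤ :=
      ENNReal.mul_ne_top hinv (ENNReal.inv_ne_top.2 hpow)
    have hdiv (x : EuclideanSpace ℝ (Fin d)) (a : ℝ≥0∞) :
        a / volume (Metric.closedBall x (ε n)) = c⁻¹ * (ENNReal.ofReal (ε n ^ d))⁻¹ * a := by
      rw [hvol x hpos, div_eq_mul_inv, ENNReal.mul_inv (Or.inl hpow) (Or.inr hc0)]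
      ring
    simp_rw [hdiv, lintegral_const_mul' _ _ hfin]
    rw [← hrpow hpos, mul_assoc]
    gcongr
end
end
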